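/- Let G be a countable amenable group, 𝒜 a finite set, Ω := 𝒜^G equipped with the σ-algebra 𝒮 generated by cylinder sets and a probability measure ℙ, and let the action τ : G × Ω → Ω, (τ_g ω)_x := ω_{xg}, be measure preserving and ergodic. Let (Q_j) be a tempered Følner sequence in G. Then there exists a set Ω̃ ⊆ Ω of full ℙ-measure such that for all ω ∈ Ω̃ and all patterns P the limit lim_{j→∞} #_P((𝒞_ω)|_{Q_j}) / |Q_j| exists, and this limit is independent of the specific choice of ω ∈ Ω̃. -/

import Mathlib

open Set Filter MeasureTheory Pointwise

/-- The number of occurrences of the pattern `P : D(P) → 𝒜` in the coloring `ω` restricted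
to `Q`. -/
noncomputable def patternCount {G : Type*} [Group G] {A : Type*} (ω : G → A)
    (Dp : Finset G) (P : G → A) (Q : Finset G) : ℕ :=
  Set.ncard {x : G | (∀ y ∈ Dp, y * x ∈ Q) ∧ ∀ y ∈ Dp, ω (y * x) = P y}

open scoped ENNReal

/-- Greedy selection by decreasing rank `i`: an index is discarded exactly when one of the points
it covers already carries weight larger than `1` from selected indices of larger rank. -/
theorem exists_greedy_selection {α β : Type*} (i : α → ℕ) (w : α → ℝ≥0∞) (R : α → β → Prop)
    (s : Finset α) :
    ∃ S ⊆ s,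
      (∀ a ∈ S, ∀ g, R a g →
        open Classical in ∑ b ∈ S with i a < i b ∧ R b g, w b ≤ 1) ∧
      ∀ a ∈ s, a ∉ S → ∃ g, R a g ∧
        open Classical in 1 < ∑ b ∈ S with i a < i b ∧ R b g, w b := by
  classical
  induction s using Finset.induction_on_min_value i with
  | empty => exact ⟨∅, by simp⟩
  | insert a s ha hmin ih =>
    obtain ⟨S, hSs, h1, h2⟩ := ih
    by_cases h : ∀ g, R a g → ∑ b ∈ S with i a < i b ∧ R b g, w b ≤ 1
    · have key : ∀ b, i a ≤ i b → ∀ g, (insert a S).filter (fun c => i b < i c ∧ R c g) =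
          S.filter (fun c => i b < i c ∧ R c g) := by
        intro b hb g
        rw [Finset.filter_insert, if_neg]
        rintro ⟨h3, -⟩
        omega
      refine ⟨insert a S, Finset.insert_subset_insert _ hSs, ?_, ?_⟩
      · intro b hb g hg
        rcases Finset.mem_insert.1 hb with rfl | hb
        · rw [key b le_rfl]; exact h g hg
        · rw [key b (hmin b (hSs hb))]; exact h1 b hb g hg
      · intro b hb hbS
        rw [Finset.mem_insert, not_or] at hbS
        have hb' := (Finset.mem_insert.1 hb).resolve_left hbS.1
        obtain ⟨g, hg, hlt⟩ := h2 b hb' hbS.2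
        refine ⟨g, hg, ?_⟩
        rw [key b (hmin b hb')]
        exact hlt
    · push Not at h
      refine ⟨S, hSs.trans (Finset.subset_insert _ _), h1, ?_⟩
      intro b hb hbS
      rcases Finset.mem_insert.1 hb with rfl | hb
      · exact h
      · exact h2 b hb hbS

/-- The weak type `(1, 1)` maximal inequality on a group, for averages over right translates of a
tempered sequence of finite sets. -/
theorem card_mul_le_sum_of_tempered {G : Type*} [Group G] (Q : ℕ → Finset G)
    (hne : ∀ j, (Q j).Nonempty) (C : ℕ)
    (htemp : ∀ n, (⋃ k ∈ Finset.range n, ((Q k : Set G))⁻¹ * (Q n : Set G)).ncard ≤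
      C * (Q n).card)
    (φ : G → ℝ≥0∞) (t : ℝ≥0∞) (s U : Finset G) (i : G → ℕ)
    (hU : ∀ a ∈ s, ∀ h ∈ Q (i a), h * a ∈ U)
    (hs : ∀ a ∈ s, t ≤ ((Q (i a)).card : ℝ≥0∞)⁻¹ * ∑ h ∈ Q (i a), φ (h * a)) :
    s.card * t ≤ 2 * (1 + C) * ∑ g ∈ U, φ g := by
  classical
  set w : G → ℝ≥0∞ := fun a => ((Q (i a)).card : ℝ≥0∞)⁻¹ with hw
  have hw1 : ∀ a, w a * (Q (i a)).card = 1 := fun a =>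
    ENNReal.inv_mul_cancel (by simpa using (hne _).ne_empty) (by simp)
  obtain ⟨S, hSs, h1, h2⟩ := exists_greedy_selection i w (fun a g => g * a⁻¹ ∈ Q (i a)) s
  have hlevel : ∀ (g : G) (m : ℕ), ∑ b ∈ S with i b = m ∧ g * b⁻¹ ∈ Q (i b), w b ≤ 1 := by
    intro g m
    have hcard : (S.filter fun b => i b = m ∧ g * b⁻¹ ∈ Q (i b)).card ≤ (Q m).card := by
      refine Finset.card_le_card_of_injOn (fun b => g * b⁻¹) ?_ ?_
      · intro b hb
        have := (Finset.mem_filter.1 hb).2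
        simpa [this.1] using this.2
      · intro b _ b' _ hbb
        simpa using hbb
    calc ∑ b ∈ S with i b = m ∧ g * b⁻¹ ∈ Q (i b), w b
        = ∑ b ∈ S with i b = m ∧ g * b⁻¹ ∈ Q (i b), ((Q m).card : ℝ≥0∞)⁻¹ := by
          refine Finset.sum_congr rfl fun b hb => ?_
          rw [hw, ← (Finset.mem_filter.1 hb).2.1]
      _ = (S.filter fun b => i b = m ∧ g * b⁻¹ ∈ Q (i b)).card * ((Q m).card : ℝ≥0∞)⁻¹ := by
          simp
      _ ≤ (Q m).card * ((Q m).card : ℝ≥0∞)⁻¹ := by gcongr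
      _ ≤ 1 := ENNReal.mul_inv_le_one _
  have hover : ∀ g, ∑ b ∈ S with g * b⁻¹ ∈ Q (i b), w b ≤ 2 := by
    intro g
    rcases (S.filter fun b => g * b⁻¹ ∈ Q (i b)).eq_empty_or_nonempty with h0 | h0
    · simp [h0]
    obtain ⟨a, ha, hamin⟩ := Finset.exists_min_image _ i h0
    have haS := Finset.mem_filter.1 ha
    calc ∑ b ∈ S with g * b⁻¹ ∈ Q (i b), w b
        ≤ ∑ b ∈ (S.filter fun b => i a < i b ∧ g * b⁻¹ ∈ Q (i b)) ∪
            (S.filter fun b => i b = i a ∧ g * b⁻¹ ∈ Q (i b)), w b := by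
          refine Finset.sum_le_sum_of_subset fun b hb => ?_
          have := hamin b hb
          have := Finset.mem_filter.1 hb
          simp only [Finset.mem_union, Finset.mem_filter]
          grind
      _ ≤ ∑ b ∈ S with i a < i b ∧ g * b⁻¹ ∈ Q (i b), w b +
            ∑ b ∈ S with i b = i a ∧ g * b⁻¹ ∈ Q (i b), w b :=
          le_self_add.trans_eq Finset.sum_union_inter
      _ ≤ 1 + 1 := by
          gcongr
          · refine le_of_eq_of_le ?_ (h1 a haS.1 g haS.2)
            congr!
          · exact hlevel g (i a)
      _ = 2 := one_add_one_eq_two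
  have hsize : (s.card : ℝ≥0∞) ≤ (1 + C) * S.card := by
    have hbad : ∀ a ∈ s \ S, 1 ≤ ∑ b ∈ S,
        if i a < i b ∧ ∃ h ∈ Q (i a), h * a * b⁻¹ ∈ Q (i b) then w b else 0 := by
      intro a ha
      obtain ⟨has, haS⟩ := Finset.mem_sdiff.1 ha
      obtain ⟨g, hg, hlt⟩ := h2 a has haS
      refine hlt.le.trans ?_
      rw [← Finset.sum_filter]
      refine Finset.sum_le_sum_of_subset fun b hb => ?_
      simp only [Finset.mem_filter] at hb ⊢
      exact ⟨hb.1, hb.2.1, g * a⁻¹, hg, by simpa using hb.2.2⟩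
    have hcount : ∀ b, (((s \ S).filter fun a =>
        i a < i b ∧ ∃ h ∈ Q (i a), h * a * b⁻¹ ∈ Q (i b)).card) ≤ C * (Q (i b)).card := by
      intro b
      refine le_trans ?_ (htemp (i b))
      rw [← Set.ncard_coe_finset]
      refine Set.ncard_le_ncard_of_injOn (fun a => a * b⁻¹) ?_ ?_ ?_
      · intro a ha
        obtain ⟨-, hlt, h, hh, hm⟩ := Finset.mem_filter.1 ha
        simp only [Set.mem_iUnion]
        refine ⟨i a, Finset.mem_range.2 hlt, Set.mem_mul.2
          ⟨h⁻¹, by simpa using hh, h * a * b⁻¹, hm, by group⟩⟩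
      · intro a _ a' _ haa
        simpa using haa
      · refine Set.Finite.biUnion (Finset.finite_toSet _) fun k _ => ?_
        exact ((Finset.finite_toSet _).inv).mul (Finset.finite_toSet _)
    have hsd : ((s \ S).card : ℝ≥0∞) ≤ C * S.card := by
      calc ((s \ S).card : ℝ≥0∞) = ∑ a ∈ s \ S, 1 := by simp
        _ ≤ ∑ a ∈ s \ S, ∑ b ∈ S,
            if i a < i b ∧ ∃ h ∈ Q (i a), h * a * b⁻¹ ∈ Q (i b) then w b else 0 :=
          Finset.sum_le_sum hbad
        _ = ∑ b ∈ S, ∑ a ∈ s \ S,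
            if i a < i b ∧ ∃ h ∈ Q (i a), h * a * b⁻¹ ∈ Q (i b) then w b else 0 :=
          Finset.sum_comm
        _ ≤ ∑ b ∈ S, (C : ℝ≥0∞) := by
          refine Finset.sum_le_sum fun b _ => ?_
          rw [← Finset.sum_filter, Finset.sum_const, nsmul_eq_mul]
          calc _ ≤ ((C * (Q (i b)).card : ℕ) : ℝ≥0∞) * w b := by
                gcongr; exact hcount b
            _ = C * (w b * (Q (i b)).card) := by push_cast; ring
            _ = C := by rw [hw1, mul_one]
        _ = C * S.card := by simp [mul_comm]
    calc (s.card : ℝ≥0∞) = ((s \ S).card + S.card : ℕ) := by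
          rw [Finset.card_sdiff_add_card_eq_card hSs]
      _ ≤ C * S.card + S.card := by push_cast; gcongr
      _ = _ := by ring
  have hmass : S.card * t ≤ 2 * ∑ g ∈ U, φ g := by
    calc S.card * t = ∑ b ∈ S, t := by simp
      _ ≤ ∑ b ∈ S, ∑ g ∈ U, if g * b⁻¹ ∈ Q (i b) then w b * φ g else 0 := by
        refine Finset.sum_le_sum fun b hb => (hs b (hSs hb)).trans ?_
        rw [← Finset.sum_filter, ← Finset.mul_sum]
        gcongr
        rw [← Finset.sum_image (s := Q (i b)) (g := fun h => h * b) (f := φ)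
          (fun x _ y _ hxy => by simpa using hxy)]
        refine Finset.sum_le_sum_of_subset fun g hg => ?_
        obtain ⟨h, hh, rfl⟩ := Finset.mem_image.1 hg
        simpa using ⟨hU b (hSs hb) h hh, hh⟩
      _ = ∑ g ∈ U, ∑ b ∈ S, if g * b⁻¹ ∈ Q (i b) then w b * φ g else 0 := Finset.sum_comm
      _ ≤ ∑ g ∈ U, 2 * φ g := by
        refine Finset.sum_le_sum fun g _ => ?_
        rw [← Finset.sum_filter, ← Finset.sum_mul]
        gcongr
        exact hover g
      _ = _ := by rw [Finset.mul_sum]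
  calc s.card * t ≤ (1 + C) * S.card * t := by gcongr
    _ = (1 + C) * (S.card * t) := by ring
    _ ≤ (1 + C) * (2 * ∑ g ∈ U, φ g) := by gcongr
    _ = _ := by ring

/-- The weak type `(1, 1)` maximal inequality for a measure preserving group action, along a
tempered sequence of finite sets that contains almost invariant ones. -/
theorem mul_measure_exists_le_avg_le {G Ω : Type*} [Group G] [MeasurableSpace Ω]
    (μ : Measure Ω) (T : G → Ω → Ω) (hT : ∀ g h ω, T g (T h ω) = T (g * h) ω)
    (hmp : ∀ g, MeasurePreserving (T g) μ μ) (Q : ℕ → Finset G) (hne : ∀ j, (Q j).Nonempty)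
    (hinv : ∀ K : Finset G, K.Nonempty →
      ∃ m, ((K : Set G) * (Q m : Set G)).ncard ≤ 2 * (Q m).card) (C : ℕ)
    (htemp : ∀ n, (⋃ k ∈ Finset.range n, ((Q k : Set G))⁻¹ * (Q n : Set G)).ncard ≤
      C * (Q n).card)
    (f : Ω → ℝ≥0∞) (hf : Measurable f) (t : ℝ≥0∞) :
    t * μ {ω | ∃ n, t ≤ ((Q n).card : ℝ≥0∞)⁻¹ * ∑ h ∈ Q n, f (T h ω)} ≤
      4 * (1 + C) * ∫⁻ ω, f ω ∂μ := by
  classical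
  set E : ℕ → Set Ω := fun N =>
    {ω | ∃ n ≤ N, t ≤ ((Q n).card : ℝ≥0∞)⁻¹ * ∑ h ∈ Q n, f (T h ω)} with hE
  have hEmeas : ∀ N, MeasurableSet (E N) := by
    intro N
    have : E N = ⋃ n, ⋃ _ : n ≤ N,
        {ω | t ≤ ((Q n).card : ℝ≥0∞)⁻¹ * ∑ h ∈ Q n, f (T h ω)} := by
      ext; simp [hE]
    rw [this]
    refine MeasurableSet.iUnion fun n => MeasurableSet.iUnion fun _ => ?_
    refine measurableSet_le measurable_const (Measurable.const_mul ?_ _)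
    exact Finset.measurable_sum _ fun h _ => hf.comp (hmp h).measurable
  have hEmono : Monotone E := fun M N hMN ω ⟨n, hn, h⟩ => ⟨n, hn.trans hMN, h⟩
  have hunion : {ω | ∃ n, t ≤ ((Q n).card : ℝ≥0∞)⁻¹ * ∑ h ∈ Q n, f (T h ω)} = ⋃ N, E N := by
    ext ω
    simp only [hE, Set.mem_ofPred_eq, Set.mem_iUnion]
    exact ⟨fun ⟨n, h⟩ => ⟨n, n, le_rfl, h⟩, fun ⟨_, n, _, h⟩ => ⟨n, h⟩⟩
  rw [hunion, hEmono.measure_iUnion, ENNReal.mul_iSup]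
  refine iSup_le fun N => ?_
  set K : Finset G := (Finset.range (N + 1)).biUnion Q with hK
  obtain ⟨m, hm⟩ := hinv K ((hne 0).mono (Finset.subset_biUnion_of_mem Q (by simp)))
  set U : Finset G := K * Q m with hUdef
  have hUcard : U.card ≤ 2 * (Q m).card := by
    rwa [← Finset.coe_mul, Set.ncard_coe_finset] at hm
  have hpt : ∀ ω, ∑ a ∈ Q m, (E N).indicator (fun _ => t) (T a ω) ≤
      2 * (1 + C) * ∑ g ∈ U, f (T g ω) := by
    intro ω
    have hex : ∀ a, ∃ n, T a ω ∈ E N → n ≤ N ∧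
        t ≤ ((Q n).card : ℝ≥0∞)⁻¹ * ∑ h ∈ Q n, f (T h (T a ω)) := by
      intro a
      by_cases h : T a ω ∈ E N
      · obtain ⟨n, hn⟩ := h
        exact ⟨n, fun _ => hn⟩
      · exact ⟨0, fun h' => absurd h' h⟩
    choose i hi using hex
    calc ∑ a ∈ Q m, (E N).indicator (fun _ => t) (T a ω)
        = ((Q m).filter fun a => T a ω ∈ E N).card * t := by
          simp only [Set.indicator_apply]
          rw [← Finset.sum_filter, Finset.sum_const, nsmul_eq_mul]
      _ ≤ _ := by
          refine card_mul_le_sum_of_tempered Q hne C htemp (fun g => f (T g ω)) t _ U i ?_ ?_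
          · intro a ha h hh
            have ha := Finset.mem_filter.1 ha
            refine Finset.mul_mem_mul (Finset.mem_biUnion.2 ⟨i a, ?_, hh⟩) ha.1
            exact Finset.mem_range_succ_iff.2 (hi a ha.2).1
          · intro a ha
            simpa only [hT] using (hi a (Finset.mem_filter.1 ha).2).2
  have hint : ((Q m).card : ℝ≥0∞) * (t * μ (E N)) ≤
      (Q m).card * (4 * (1 + C) * ∫⁻ ω, f ω ∂μ) := by
    have hind : Measurable ((E N).indicator fun _ => t) := measurable_const.indicator (hEmeas N)
    calc ((Q m).card : ℝ≥0∞) * (t * μ (E N))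
        = ∫⁻ ω, ∑ a ∈ Q m, (E N).indicator (fun _ => t) (T a ω) ∂μ := by
          rw [lintegral_finsetSum (Q m) (f := fun a ω => (E N).indicator (fun _ => t) (T a ω))
            fun a _ => hind.comp (hmp a).measurable]
          simp_rw [fun a => (hmp a).lintegral_comp hind]
          simp [lintegral_indicator (hEmeas N)]
      _ ≤ ∫⁻ ω, 2 * (1 + C) * ∑ g ∈ U, f (T g ω) ∂μ := lintegral_mono hpt
      _ = 2 * (1 + C) * (U.card * ∫⁻ ω, f ω ∂μ) := by
          rw [lintegral_const_mul _ (f := fun ω => ∑ g ∈ U, f (T g ω))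
            (Finset.measurable_sum _ fun g _ => hf.comp (hmp g).measurable),
            lintegral_finsetSum U (f := fun g ω => f (T g ω))
            fun g _ => hf.comp (hmp g).measurable]
          simp_rw [fun g => (hmp g).lintegral_comp hf]
          simp
      _ ≤ 2 * (1 + C) * ((2 * (Q m).card : ℕ) * ∫⁻ ω, f ω ∂μ) := by gcongr
      _ = _ := by push_cast; ring
  exact (ENNReal.mul_le_mul_iff_right (by simpa using (hne m).ne_empty) (by simp)).1 hint

/-- The average of `f` over the translates of `ω` by the elements of `s`. -/
noncomputable def orbitAvg {G Ω : Type*} (T : G → Ω → Ω) (s : Finset G) (f : Ω → ℝ) (ω : Ω) : ℝ :=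
  (s.card : ℝ)⁻¹ * ∑ g ∈ s, f (T g ω)

/-- The functions whose orbit averages tend to zero almost everywhere are closed in `L¹`. -/
theorem ae_tendsto_orbitAvg_zero_of_approx {G Ω : Type*} [Group G] [MeasurableSpace Ω]
    (μ : Measure Ω) (T : G → Ω → Ω) (hT : ∀ g h ω, T g (T h ω) = T (g * h) ω)
    (hmp : ∀ g, MeasurePreserving (T g) μ μ) (Q : ℕ → Finset G) (hne : ∀ j, (Q j).Nonempty)
    (hinv : ∀ K : Finset G, K.Nonempty →
      ∃ m, ((K : Set G) * (Q m : Set G)).ncard ≤ 2 * (Q m).card) (C : ℕ)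
    (htemp : ∀ n, (⋃ k ∈ Finset.range n, ((Q k : Set G))⁻¹ * (Q n : Set G)).ncard ≤
      C * (Q n).card)
    (f : Ω → ℝ) (hf : Measurable f)
    (happ : ∀ ε : ℝ≥0∞, ε ≠ 0 → ∃ f' : Ω → ℝ, Measurable f' ∧
      (∀ᵐ ω ∂μ, Tendsto (fun j => orbitAvg T (Q j) f' ω) atTop (nhds 0)) ∧
      ∫⁻ ω, ‖f ω - f' ω‖ₑ ∂μ ≤ ε) :
    ∀ᵐ ω ∂μ, Tendsto (fun j => orbitAvg T (Q j) f ω) atTop (nhds 0) := by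
  have key : ∀ t : ℝ, 0 < t →
      ∀ᵐ ω ∂μ, ∀ᶠ j in atTop, ‖orbitAvg T (Q j) f ω‖ < 2 * t := by
    intro t ht
    rw [ae_iff]
    have ht0 : ENNReal.ofReal t ≠ 0 := by simpa using ht
    set D : ℝ≥0∞ := 4 * (1 + C) with hD
    have hD0 : D ≠ 0 := by simp [hD]
    have hDt : D ≠ ∞ := by simp [hD, ENNReal.mul_eq_top]
    set bad : Set Ω := {ω | ¬ ∀ᶠ j in atTop, ‖orbitAvg T (Q j) f ω‖ < 2 * t} with hbad
    suffices h : ENNReal.ofReal t * μ bad ≤ 0 by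
      simpa [ht0, ht.not_ge] using h
    refine ENNReal.le_of_forall_pos_le_add fun ε hε _ => ?_
    obtain ⟨f', hf', hconv, hint⟩ := happ (ε / D)
      (ENNReal.div_ne_zero.2 ⟨by simpa using hε.ne', hDt⟩)
    have hsub : μ bad ≤ μ {ω | ∃ n, ENNReal.ofReal t ≤
        ((Q n).card : ℝ≥0∞)⁻¹ * ∑ h ∈ Q n, ‖f (T h ω) - f' (T h ω)‖ₑ} := by
      refine measure_mono_ae ?_
      filter_upwards [hconv] with ω hω hbadω
      by_contra hcon
      refine hbadω ?_
      have hcon' : ∀ n, ((Q n).card : ℝ≥0∞)⁻¹ * ∑ h ∈ Q n, ‖f (T h ω) - f' (T h ω)‖ₑ <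
          ENNReal.ofReal t := fun n => not_le.1 fun h => hcon ⟨n, h⟩
      rw [NormedAddGroup.tendsto_nhds_zero] at hω
      filter_upwards [hω t ht] with j hj
      have hdiff : ‖orbitAvg T (Q j) f ω - orbitAvg T (Q j) f' ω‖ < t := by
        rw [← ENNReal.ofReal_lt_ofReal_iff ht, ofReal_norm]
        refine lt_of_le_of_lt ?_ (hcon' j)
        rw [orbitAvg, orbitAvg, ← mul_sub, ← Finset.sum_sub_distrib, enorm_mul]
        gcongr
        · rw [enorm_inv (by simpa using (hne j).ne_empty)]
          simp
        · exact enorm_sum_le _ _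
      calc ‖orbitAvg T (Q j) f ω‖
          ≤ ‖orbitAvg T (Q j) f ω - orbitAvg T (Q j) f' ω‖ + ‖orbitAvg T (Q j) f' ω‖ :=
            norm_le_norm_sub_add _ _
        _ < 2 * t := by linarith
    calc ENNReal.ofReal t * μ bad ≤ D * ∫⁻ ω, ‖f ω - f' ω‖ₑ ∂μ :=
          (mul_le_mul_right hsub _).trans <| mul_measure_exists_le_avg_le μ T hT hmp Q hne hinv C
            htemp (fun ω => ‖f ω - f' ω‖ₑ) (hf.sub hf').enorm _
      _ ≤ D * (ε / D) := by gcongr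
      _ = 0 + ε := by rw [ENNReal.mul_div_cancel hD0 hDt, zero_add]
  have hall : ∀ᵐ ω ∂μ, ∀ k : ℕ, ∀ᶠ j in atTop,
      ‖orbitAvg T (Q j) f ω‖ < 2 * (1 / ((k : ℝ) + 1)) :=
    ae_all_iff.2 fun k => key _ Nat.one_div_pos_of_nat
  filter_upwards [hall] with ω hω
  rw [NormedAddGroup.tendsto_nhds_zero]
  intro ε hε
  obtain ⟨k, hk⟩ := exists_nat_one_div_lt (half_pos hε)
  filter_upwards [hω k] with j hj
  linarith

/-- A function invariant under an ergodic action of a countable group is almost everywhere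
constant. -/
theorem exists_ae_eq_const_of_comp_ae_eq {G Ω : Type*} [Group G] [Countable G]
    [MeasurableSpace Ω] (μ : Measure Ω) [IsProbabilityMeasure μ] (T : G → Ω → Ω)
    (hT : ∀ g h ω, T g (T h ω) = T (g * h) ω) (hT1 : ∀ ω, T 1 ω = ω)
    (hmeas : ∀ g, Measurable (T g))
    (herg : ∀ s, MeasurableSet s → (∀ g, T g ⁻¹' s = s) → μ s = 0 ∨ μ s = 1)
    (f : Ω → ℝ) (hf : Measurable f) (hinv : ∀ g, f ∘ T g =ᵐ[μ] f) :
    ∃ c, f =ᵐ[μ] Function.const Ω c := by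
  refine exists_eventuallyEq_const_of_forall_separating MeasurableSet fun U hU => ?_
  set s : Set Ω := ⋂ g, T g ⁻¹' (f ⁻¹' U) with hs
  have hsm : MeasurableSet s := MeasurableSet.iInter fun g => hmeas g (hf hU)
  have hsinv : ∀ g, T g ⁻¹' s = s := by
    intro g
    ext ω
    simp only [hs, Set.mem_preimage, Set.mem_iInter, hT]
    exact ⟨fun h k => by simpa using h (k * g⁻¹), fun h k => h (k * g)⟩
  have hae : ∀ᵐ ω ∂μ, (ω ∈ s ↔ f ω ∈ U) := by
    filter_upwards [ae_all_iff.2 hinv] with ω hω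
    simp only [hs, Set.mem_preimage, Set.mem_iInter]
    refine ⟨fun h => by simpa [hT1] using h 1, fun h g => ?_⟩
    have := hω g
    simp only [Function.comp_apply] at this
    rwa [this]
  rcases herg s hsm hsinv with h | h
  · right
    filter_upwards [hae, measure_eq_zero_iff_ae_notMem.1 h] with ω h1 h2
    rwa [← h1]
  · left
    filter_upwards [hae, (prob_compl_eq_zero_iff hsm).2 h] with ω h1 h2
    rw [← h1]
    simpa using h2

/-- The pointwise ergodic theorem for an ergodic action and an indicator function, along a
tempered Følner sequence. -/
theorem ae_tendsto_orbitAvg_indicator {G Ω : Type*} [Group G] [Countable G]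
    [MeasurableSpace Ω] (μ : Measure Ω) [IsProbabilityMeasure μ] (T : G → Ω → Ω)
    (hT : ∀ g h ω, T g (T h ω) = T (g * h) ω) (hT1 : ∀ ω, T 1 ω = ω)
    (hmp : ∀ g, MeasurePreserving (T g) μ μ)
    (herg : ∀ s, MeasurableSet s → (∀ g, T g ⁻¹' s = s) → μ s = 0 ∨ μ s = 1)
    (Q : ℕ → Finset G) (hne : ∀ j, (Q j).Nonempty)
    (hfol : ∀ K : Finset G, K.Nonempty →
      Tendsto (fun j =>
        ((symmDiff ((Q j : Set G)) ((K : Set G) * (Q j : Set G))).ncard : ℝ) / ((Q j).card : ℝ))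
        atTop (nhds 0)) (C : ℕ)
    (htemp : ∀ n, (⋃ k ∈ Finset.range n, ((Q k : Set G))⁻¹ * (Q n : Set G)).ncard ≤
      C * (Q n).card)
    (E : Set Ω) (hE : MeasurableSet E) :
    ∀ᵐ ω ∂μ, Tendsto (fun j => orbitAvg T (Q j) (E.indicator 1) ω) atTop (nhds (μ.real E)) := by
  classical
  have hpos : ∀ j, (0 : ℝ) < (Q j).card := fun j => by exact_mod_cast (hne j).card_pos
  have hinv : ∀ K : Finset G, K.Nonempty →
      ∃ m, ((K : Set G) * (Q m : Set G)).ncard ≤ 2 * (Q m).card := by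
    intro K hK
    obtain ⟨m, hm⟩ := ((hfol K hK).eventually (gt_mem_nhds one_pos)).exists
    refine ⟨m, ?_⟩
    rw [div_lt_one (hpos m), Nat.cast_lt] at hm
    have hsub : (K : Set G) * (Q m : Set G) ⊆
        (Q m : Set G) ∪ symmDiff (Q m : Set G) ((K : Set G) * (Q m : Set G)) := by
      intro x hx
      by_cases h : x ∈ (Q m : Set G)
      · exact Or.inl h
      · exact Or.inr (Or.inr ⟨hx, h⟩)
    have hfin : (symmDiff (Q m : Set G) ((K : Set G) * (Q m : Set G))).Finite :=
      (Finset.finite_toSet _).symmDiff (K.finite_toSet.mul (Q m).finite_toSet)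
    calc _ ≤ _ := Set.ncard_le_ncard hsub ((Finset.finite_toSet _).union hfin)
      _ ≤ _ := Set.ncard_union_le _ _
      _ ≤ 2 * (Q m).card := by rw [Set.ncard_coe_finset]; omega
  have hcongr : ∀ f f' : Ω → ℝ, f =ᵐ[μ] f' →
      (∀ᵐ ω ∂μ, Tendsto (fun j => orbitAvg T (Q j) f ω) atTop (nhds 0)) →
      ∀ᵐ ω ∂μ, Tendsto (fun j => orbitAvg T (Q j) f' ω) atTop (nhds 0) := by
    intro f f' hff hf
    have hall : ∀ᵐ ω ∂μ, ∀ g, f (T g ω) = f' (T g ω) :=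
      ae_all_iff.2 fun g => (hmp g).quasiMeasurePreserving.ae_eq_comp hff
    filter_upwards [hf, hall] with ω h1 h2
    simpa only [orbitAvg, h2] using h1
  -- coboundaries of indicator functions
  set Bset : Set (Lp ℝ 2 μ) := {v | ∃ (s : Set Ω) (hs : MeasurableSet s) (g : G),
    v = indicatorConstLp 2 hs (measure_ne_top μ s) (1 : ℝ) -
      indicatorConstLp 2 ((hmp g).measurable hs) (measure_ne_top μ _) (1 : ℝ)} with hBset
  have hBconv : ∀ v ∈ Submodule.span ℝ Bset,
      ∀ᵐ ω ∂μ, Tendsto (fun j => orbitAvg T (Q j) v ω) atTop (nhds 0) := by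
    intro v hv
    induction hv using Submodule.span_induction with
    | mem v hv =>
      obtain ⟨s, hs, g, rfl⟩ := hv
      refine hcongr (fun ω => s.indicator 1 ω - s.indicator 1 (T g ω)) _ ?_ ?_
      · filter_upwards [Lp.coeFn_sub (indicatorConstLp 2 hs (measure_ne_top μ s) (1 : ℝ))
          (indicatorConstLp 2 ((hmp g).measurable hs) (measure_ne_top μ _) (1 : ℝ)),
          indicatorConstLp_coeFn (p := 2) (hs := hs) (hμs := measure_ne_top μ s) (c := (1 : ℝ)),
          indicatorConstLp_coeFn (p := 2) (hs := (hmp g).measurable hs)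
            (hμs := measure_ne_top μ _) (c := (1 : ℝ))] with ω h1 h2 h3
        rw [h1, Pi.sub_apply, h2, h3]
        simp [Set.indicator_apply]
      · refine Eventually.of_forall fun ω => ?_
        refine squeeze_zero_norm (fun j => ?_) (hfol {g} (Finset.singleton_nonempty g))
        have hshift : ∑ h ∈ Q j, s.indicator (1 : Ω → ℝ) (T g (T h ω)) =
            ∑ h ∈ (Q j).image (g * ·), s.indicator (1 : Ω → ℝ) (T h ω) := by
          rw [Finset.sum_image fun x _ y _ hxy => by simpa using hxy]
          simp_rw [hT]
        have hcoe : ((({g} : Finset G) : Set G) * (Q j : Set G)) =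
            (((Q j).image (g * ·) : Finset G) : Set G) := by
          simp
        rw [hcoe, ← Finset.coe_symmDiff, Set.ncard_coe_finset, orbitAvg,
          Finset.sum_sub_distrib, hshift, norm_mul, norm_inv, Real.norm_natCast, div_eq_inv_mul]
        gcongr
        have hle : ∀ t : Finset G, ‖∑ h ∈ t, s.indicator (1 : Ω → ℝ) (T h ω)‖ ≤ t.card := by
          intro t
          refine (norm_sum_le_of_le t (f := fun h => s.indicator (1 : Ω → ℝ) (T h ω))
            (n := fun _ => 1) fun h _ => ?_).trans (by simp)
          simpa using norm_indicator_le_norm_self (1 : Ω → ℝ) (T h ω) (s := s)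
        rw [← Finset.sum_sdiff_sub_sum_sdiff, symmDiff, Finset.sup_eq_union,
          Finset.card_union_of_disjoint disjoint_sdiff_sdiff, Nat.cast_add]
        exact (norm_sub_le _ _).trans (add_le_add (hle _) (hle _))
    | zero =>
      refine hcongr 0 _ (Lp.coeFn_zero ℝ 2 μ).symm (Eventually.of_forall fun ω => ?_)
      simp [orbitAvg]
    | add u v _ _ hu hv =>
      refine hcongr (u + v) _ (Lp.coeFn_add u v).symm ?_
      filter_upwards [hu, hv] with ω h1 h2
      simpa [orbitAvg, Finset.sum_add_distrib, mul_add] using h1.add h2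
    | smul c v _ hv =>
      refine hcongr (c • v) _ (Lp.coeFn_smul c v).symm ?_
      filter_upwards [hv] with ω h1
      have := h1.const_mul c
      simp only [orbitAvg, mul_zero] at this ⊢
      refine this.congr fun j => ?_
      simp only [Pi.smul_apply, smul_eq_mul, ← Finset.mul_sum]
      ring
  set w : Lp ℝ 2 μ := indicatorConstLp 2 hE (measure_ne_top μ E) (1 : ℝ) -
    μ.real E • indicatorConstLp 2 MeasurableSet.univ (measure_ne_top μ _) (1 : ℝ) with hw
  have hwmem : w ∈ (Submodule.span ℝ Bset).topologicalClosure := by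
    rw [← Submodule.orthogonal_orthogonal_eq_closure, Submodule.mem_orthogonal']
    intro v hv
    have hvint : Integrable v μ := (Lp.memLp v).integrable (by norm_num)
    have hvm : Measurable v := (Lp.stronglyMeasurable v).measurable
    have hset : ∀ s, MeasurableSet s → ∀ g, ∫ ω in T g ⁻¹' s, v ω ∂μ = ∫ ω in s, v ω ∂μ := by
      intro s hs g
      have := (Submodule.mem_orthogonal _ _).1 hv _ (Submodule.subset_span ⟨s, hs, g, rfl⟩)
      rw [inner_sub_left, L2.inner_indicatorConstLp_one, L2.inner_indicatorConstLp_one] at this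
      linarith
    have hvinv : ∀ g, v ∘ T g =ᵐ[μ] v := by
      intro g
      refine Integrable.ae_eq_of_forall_setIntegral_eq _ _
        ((hmp g).integrable_comp_of_integrable hvint) hvint fun s hs _ => ?_
      have hpre : T g ⁻¹' (T g⁻¹ ⁻¹' s) = s := by
        ext ω; simp [hT, hT1]
      have hs' : MeasurableSet (T g⁻¹ ⁻¹' s) := (hmp g⁻¹).measurable hs
      calc ∫ ω in s, (v ∘ T g) ω ∂μ = ∫ ω in T g ⁻¹' (T g⁻¹ ⁻¹' s), v (T g ω) ∂μ := by
            rw [hpre]; rfl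
        _ = ∫ ω in T g⁻¹ ⁻¹' s, v ω ∂(μ.map (T g)) :=
            (setIntegral_map hs' hvm.aestronglyMeasurable (hmp g).aemeasurable).symm
        _ = ∫ ω in s, v ω ∂μ := by rw [(hmp g).map_eq, hset s hs]
    obtain ⟨c, hc⟩ := exists_ae_eq_const_of_comp_ae_eq μ T hT hT1 (fun g => (hmp g).measurable)
      herg v hvm hvinv
    have hconst : ∀ s, MeasurableSet s → ∫ ω in s, v ω ∂μ = μ.real s * c := by
      intro s hs
      rw [setIntegral_congr_ae (g := fun _ => c) hs (hc.mono fun ω h _ => h)]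
      simp
    rw [hw, inner_sub_left, inner_smul_left, L2.inner_indicatorConstLp_one,
      L2.inner_indicatorConstLp_one, hconst _ hE, hconst _ MeasurableSet.univ]
    simp
  have hwconv : ∀ᵐ ω ∂μ, Tendsto (fun j => orbitAvg T (Q j) w ω) atTop (nhds 0) := by
    refine ae_tendsto_orbitAvg_zero_of_approx μ T hT hmp Q hne hinv C htemp w
      (Lp.stronglyMeasurable w).measurable fun ε hε => ?_
    obtain ⟨v, hv, hlt⟩ := EMetric.mem_closure_iff.1 hwmem ε (pos_iff_ne_zero.2 hε)
    refine ⟨v, (Lp.stronglyMeasurable v).measurable, hBconv v hv, ?_⟩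
    calc ∫⁻ ω, ‖w ω - v ω‖ₑ ∂μ = eLpNorm (⇑w - ⇑v) 1 μ := by
          rw [eLpNorm_one_eq_lintegral_enorm]; rfl
      _ ≤ eLpNorm (⇑w - ⇑v) 2 μ := eLpNorm_le_eLpNorm_of_exponent_le (by norm_num)
          ((Lp.aestronglyMeasurable w).sub (Lp.aestronglyMeasurable v))
      _ = edist w v := (Lp.edist_def w v).symm
      _ ≤ ε := hlt.le
  have hdiff := hcongr w (fun ω => E.indicator 1 ω - μ.real E) (by
    filter_upwards [Lp.coeFn_sub (indicatorConstLp 2 hE (measure_ne_top μ E) (1 : ℝ))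
      (μ.real E • indicatorConstLp 2 MeasurableSet.univ (measure_ne_top μ _) (1 : ℝ)),
      Lp.coeFn_smul (μ.real E)
        (indicatorConstLp 2 MeasurableSet.univ (measure_ne_top μ _) (1 : ℝ)),
      indicatorConstLp_coeFn (p := 2) (hs := hE) (hμs := measure_ne_top μ E) (c := (1 : ℝ)),
      indicatorConstLp_coeFn (p := 2) (hs := MeasurableSet.univ)
        (hμs := measure_ne_top μ _) (c := (1 : ℝ))] with ω h1 h2 h3 h4
    rw [h1, Pi.sub_apply, h2, Pi.smul_apply, h3, h4]
    simp [Set.indicator_apply]) hwconv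
  filter_upwards [hdiff] with ω hω
  have := hω.add_const (μ.real E)
  rw [zero_add] at this
  refine this.congr fun j => ?_
  rw [orbitAvg, orbitAvg, Finset.sum_sub_distrib, Finset.sum_const, nsmul_eq_mul, mul_sub,
    inv_mul_cancel_left₀ (hpos j).ne', sub_add_cancel]

/-- Up to boundary terms, counting a pattern inside `s` is counting the points of `s` at which the
pattern occurs. -/
theorem abs_patternCount_sub_le {G : Type*} [Group G] {A : Type*} (ω : G → A) (Dp : Finset G)
    (y₀ : G) (hy₀ : y₀ ∈ Dp) (Pp : G → A) (s : Finset G) :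
    |(patternCount ω Dp Pp s : ℝ) -
        ∑ x ∈ s, {ω : G → A | ∀ y ∈ Dp, ω y = Pp y}.indicator (1 : (G → A) → ℝ)
          (fun y => ω (y * x))| ≤
      (symmDiff (s : Set G) ((({y₀⁻¹} : Finset G) : Set G) * (s : Set G))).ncard +
      ∑ y ∈ Dp, ((symmDiff (s : Set G) ((({y} : Finset G) : Set G) * (s : Set G))).ncard : ℝ) := by
  classical
  have hfin : ∀ y : G,
      (symmDiff (s : Set G) ((({y} : Finset G) : Set G) * (s : Set G))).Finite := fun y =>
    s.finite_toSet.symmDiff ((Finset.finite_toSet _).mul s.finite_toSet)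
  set S₁ : Set G := {x | (∀ y ∈ Dp, y * x ∈ s) ∧ ∀ y ∈ Dp, ω (y * x) = Pp y} with hS₁
  set S₂ : Finset G := s.filter fun x => ∀ y ∈ Dp, ω (y * x) = Pp y with hS₂
  have hsum : ∑ x ∈ s, {ω : G → A | ∀ y ∈ Dp, ω y = Pp y}.indicator (1 : (G → A) → ℝ)
      (fun y => ω (y * x)) = S₂.card := by
    simp [Set.indicator_apply, hS₂]
  have h₁ : S₁ ⊆ S₂ ∪ symmDiff (s : Set G) ((({y₀⁻¹} : Finset G) : Set G) * (s : Set G)) := by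
    intro x hx
    by_cases hxs : x ∈ s
    · exact Or.inl (by simpa [hS₂] using ⟨hxs, hx.2⟩)
    · refine Or.inr (Or.inr ⟨Set.mem_mul.2 ⟨y₀⁻¹, by simp, y₀ * x, hx.1 y₀ hy₀, by simp⟩, hxs⟩)
  have hS₁fin : S₁.Finite := (S₂.finite_toSet.union (hfin _)).subset h₁
  have hout : ∀ y ∈ Dp, (s.filter fun x => y * x ∉ s).card ≤
      (symmDiff (s : Set G) ((({y} : Finset G) : Set G) * (s : Set G))).ncard := by
    intro y _
    rw [← Set.ncard_coe_finset]
    refine Set.ncard_le_ncard_of_injOn (fun x => y * x) ?_ ?_ (hfin y)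
    · intro x hx
      have hx := Finset.mem_filter.1 hx
      exact Or.inr ⟨Set.mul_mem_mul (by simp) hx.1, hx.2⟩
    · intro x _ x' _ hxx
      simpa using hxx
  have h₂ : (S₂ : Set G) ⊆ S₁ ∪ (Dp.biUnion fun y => s.filter fun x => y * x ∉ s : Finset G) := by
    intro x hx
    have hx := Finset.mem_filter.1 hx
    by_cases h : ∀ y ∈ Dp, y * x ∈ s
    · exact Or.inl ⟨h, hx.2⟩
    · push Not at h
      obtain ⟨y, hy, hyx⟩ := h
      refine Or.inr (Finset.mem_coe.2 (Finset.mem_biUnion.2 ⟨y, hy, ?_⟩))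
      exact Finset.mem_filter.2 ⟨hx.1, hyx⟩
  have hc₁ : S₁.ncard ≤ S₂.card +
      (symmDiff (s : Set G) ((({y₀⁻¹} : Finset G) : Set G) * (s : Set G))).ncard := by
    rw [← Set.ncard_coe_finset S₂]
    exact (Set.ncard_le_ncard h₁ (S₂.finite_toSet.union (hfin _))).trans (Set.ncard_union_le _ _)
  have hc₂ : S₂.card ≤ S₁.ncard +
      ∑ y ∈ Dp, (symmDiff (s : Set G) ((({y} : Finset G) : Set G) * (s : Set G))).ncard := by
    rw [← Set.ncard_coe_finset S₂]
    refine (Set.ncard_le_ncard h₂ (hS₁fin.union (Finset.finite_toSet _))).trans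
      ((Set.ncard_union_le _ _).trans ?_)
    rw [Set.ncard_coe_finset]
    gcongr
    exact Finset.card_biUnion_le.trans (Finset.sum_le_sum hout)
  rw [hsum, show patternCount ω Dp Pp s = S₁.ncard from rfl, abs_le]
  have hc₁' : (S₁.ncard : ℝ) ≤ S₂.card +
      (symmDiff (s : Set G) ((({y₀⁻¹} : Finset G) : Set G) * (s : Set G))).ncard := by
    exact_mod_cast hc₁
  have hc₂' : (S₂.card : ℝ) ≤ S₁.ncard + ∑ y ∈ Dp,
      ((symmDiff (s : Set G) ((({y} : Finset G) : Set G) * (s : Set G))).ncard : ℝ) := by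
    exact_mod_cast hc₂
  have hn : (0 : ℝ) ≤ ∑ y ∈ Dp,
      ((symmDiff (s : Set G) ((({y} : Finset G) : Set G) * (s : Set G))).ncard : ℝ) := by
    positivity
  constructor <;> linarith [(Nat.cast_nonneg _ : (0 : ℝ) ≤
    (symmDiff (s : Set G) ((({y₀⁻¹} : Finset G) : Set G) * (s : Set G))).ncard)]

/-- Along a Følner sequence the cardinality of the group divided by that of the sets converges. -/
theorem exists_tendsto_natCard_div {G : Type*} [Group G] (Q : ℕ → Finset G)
    (hne : ∀ j, (Q j).Nonempty)
    (hfol : ∀ K : Finset G, K.Nonempty →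
      Tendsto (fun j =>
        ((symmDiff ((Q j : Set G)) ((K : Set G) * (Q j : Set G))).ncard : ℝ) / ((Q j).card : ℝ))
        atTop (nhds 0)) :
    ∃ a : ℝ, Tendsto (fun j => (Nat.card G : ℝ) / ((Q j).card : ℝ)) atTop (nhds a) := by
  classical
  rcases finite_or_infinite G with h | h
  · have := Fintype.ofFinite G
    refine ⟨1, ?_⟩
    have h1 := (hfol Finset.univ Finset.univ_nonempty).add_const 1
    rw [zero_add] at h1
    refine h1.congr fun j => ?_
    have hmul : (Finset.univ : Finset G) * Q j = Finset.univ := by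
      obtain ⟨x, hx⟩ := hne j
      exact Finset.eq_univ_of_forall fun g =>
        Finset.mem_mul.2 ⟨g * x⁻¹, Finset.mem_univ _, x, hx, by simp⟩
    have hcard : ((Q j).card : ℝ) ≠ 0 := by simpa using (hne j).ne_empty
    rw [← Finset.coe_mul, hmul, ← Finset.coe_symmDiff, Set.ncard_coe_finset,
      ← Finset.top_eq_univ, symmDiff_top, hnot_eq_compl, Finset.card_compl,
      Nat.cast_sub (Finset.card_le_univ (Q j)), Nat.card_eq_fintype_card]
    field_simp
    ring
  · exact ⟨0, by simp⟩

/-- Existence of pattern frequencies for a randomly colored amenable group, along a tempered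
Følner sequence, for an ergodic measure preserving translation action. -/
theorem stmt_13 {G : Type*} [Group G] [Countable G]
    {A : Type*} [Fintype A] [MeasurableSpace A] [MeasurableSingletonClass A]
    (P : Measure (G → A)) [IsProbabilityMeasure P]
    -- the translation action is measure preserving:
    (hmp : ∀ g : G, MeasurePreserving (fun ω : G → A => fun x => ω (x * g)) P P)
    -- the translation action is ergodic:
    (herg : ∀ s : Set (G → A), MeasurableSet s →
      (∀ g : G, (fun ω : G → A => fun x => ω (x * g)) ⁻¹' s = s) → P s = 0 ∨ P s = 1)
    (Q : ℕ → Finset G) (hne : ∀ j, (Q j).Nonempty)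
    -- (Q_j) is a Følner sequence:
    (hfol : ∀ K : Finset G, K.Nonempty →
      Tendsto (fun j =>
        ((symmDiff ((Q j : Set G)) ((K : Set G) * (Q j : Set G))).ncard : ℝ) / ((Q j).card : ℝ))
        atTop (nhds 0))
    -- (Q_j) is tempered:
    (htemp : ∃ c : ℝ, 0 < c ∧ ∀ n : ℕ,
      (((⋃ k ∈ Finset.range n, ((Q k : Set G))⁻¹ * (Q n : Set G)).ncard : ℝ)) ≤
        c * ((Q n).card : ℝ)) :
    ∃ Ωt : Set (G → A), P Ωt = 1 ∧
      ∃ ν : Finset G → (G → A) → ℝ,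
        ∀ ω ∈ Ωt, ∀ (Dp : Finset G) (Pp : G → A),
          Tendsto (fun j => (patternCount ω Dp Pp (Q j) : ℝ) / ((Q j).card : ℝ))
            atTop (nhds (ν Dp Pp)) := by
  classical
  obtain ⟨c, -, hc⟩ := htemp
  have htemp' : ∀ n, (⋃ k ∈ Finset.range n, ((Q k : Set G))⁻¹ * (Q n : Set G)).ncard ≤
      ⌈c⌉₊ * (Q n).card := by
    intro n
    have h := (hc n).trans (mul_le_mul_of_nonneg_right (Nat.le_ceil c) (Nat.cast_nonneg _))
    exact_mod_cast h
  obtain ⟨a, ha⟩ := exists_tendsto_natCard_div Q hne hfol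
  have hae : ∀ᵐ ω ∂P, ∀ (Dp : Finset G) (p : Dp → A),
      Tendsto (fun j => orbitAvg (fun g (ω : G → A) x => ω (x * g)) (Q j)
        ({ω : G → A | ∀ y : Dp, ω y = p y}.indicator 1) ω) atTop
        (nhds (P.real {ω : G → A | ∀ y : Dp, ω y = p y})) := by
    refine ae_all_iff.2 fun Dp => ae_all_iff.2 fun p => ?_
    refine ae_tendsto_orbitAvg_indicator P (fun g (ω : G → A) x => ω (x * g)) ?_ ?_ hmp herg Q hne
      hfol ⌈c⌉₊ htemp' _ ?_
    · intro g h ω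
      simp [mul_assoc]
    · simp
    · have : {ω : G → A | ∀ y : Dp, ω y = p y} = ⋂ y : Dp, (fun ω : G → A => ω y) ⁻¹' {p y} := by
        ext; simp
      rw [this]
      exact MeasurableSet.iInter fun y => measurable_pi_apply _ (measurableSet_singleton _)
  refine ⟨_, (measure_congr (eventuallyEq_univ.2 hae)).trans measure_univ,
    fun Dp Pp => if Dp.Nonempty then P.real {ω : G → A | ∀ y ∈ Dp, ω y = Pp y} else a, ?_⟩
  intro ω hω Dp Pp
  rcases Dp.eq_empty_or_nonempty with rfl | ⟨y₀, hy₀⟩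
  · simpa [patternCount, Set.ncard_univ] using ha
  have hmain := hω Dp (fun y => Pp y)
  have hset : {ω : G → A | ∀ y : Dp, ω y = Pp y} = {ω : G → A | ∀ y ∈ Dp, ω y = Pp y} := by
    ext; simp
  rw [hset] at hmain
  simp only [if_pos (show Dp.Nonempty from ⟨y₀, hy₀⟩)]
  have herr := (hfol {y₀⁻¹} (Finset.singleton_nonempty _)).add
    (tendsto_finsetSum Dp fun y _ => hfol {y} (Finset.singleton_nonempty y))
  simp only [Finset.sum_const_zero, add_zero] at herr
  have hdiff := squeeze_zero_norm (f := fun j =>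
    (patternCount ω Dp Pp (Q j) : ℝ) / ((Q j).card : ℝ) -
      orbitAvg (fun g (ω : G → A) x => ω (x * g)) (Q j)
        ({ω : G → A | ∀ y ∈ Dp, ω y = Pp y}.indicator 1) ω) (fun j => ?_) herr
  · have h := hdiff.add hmain
    rw [zero_add] at h
    exact h.congr fun j => sub_add_cancel _ _
  · rw [orbitAvg, ← div_eq_inv_mul, ← sub_div, ← Finset.sum_div, ← add_div, norm_div,
      Real.norm_natCast, Real.norm_eq_abs]
    gcongr
    exact abs_patternCount_sub_le ω Dp y₀ hy₀ Pp (Q j)
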